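/- Let c ∈ ℤ_{≥0}^n and 0 < ε < 1/2. If c̃ ∈ ℤ^n is x*(ε)-critical, then the vector c̃⁺ ∈ ℤ_{≥0}^n defined by c̃⁺_i = max{c̃_i, 0} is also x*(ε)-critical, and ‖c̃⁺‖₁ ≤ ‖c̃‖₁. -/

import Mathlib

open Finset

/-- The point `x*(ε) = (1/2+ε, …, 1/2+ε)`. -/
noncomputable def xstar (n : ℕ) (ε : ℝ) : Fin n → ℝ := fun _ => 1 / 2 + ε

/-- `K(c) = {x ∈ {0,1}ⁿ : c·x ≤ ‖c‖₁/2}`. -/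
def Kset {n : ℕ} (c : Fin n → ℤ) : Set (Fin n → ℝ) :=
  {x | (∀ i, x i = 0 ∨ x i = 1) ∧ ∑ i, (c i : ℝ) * x i ≤ (∑ i, |(c i : ℝ)|) / 2}

/-- `c̃` is `x*(ε)`-critical: `c̃·x*(ε) ≥ max{c̃·x : x ∈ K(c)}`. -/
def IsCritical {n : ℕ} (c : Fin n → ℤ) (ε : ℝ) (ct : Fin n → ℤ) : Prop :=
  ∀ x ∈ Kset c, ∑ i, (ct i : ℝ) * x i ≤ ∑ i, (ct i : ℝ) * xstar n ε i

/-- If `c̃ ∈ ℤⁿ` is `x*(ε)`-critical, then so is `c̃⁺` with `c̃⁺ᵢ = max{c̃ᵢ, 0}`, and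
moreover `‖c̃⁺‖₁ ≤ ‖c̃‖₁`. -/
theorem positive_part_critical (n : ℕ) (c : Fin n → ℤ) (hc : ∀ i, 0 ≤ c i)
    (ε : ℝ) (hε0 : 0 < ε) (hε : ε < 1 / 2)
    (ct : Fin n → ℤ) (hcrit : IsCritical c ε ct) :
    IsCritical c ε (fun i => max (ct i) 0) ∧
      (∑ i, |((max (ct i) 0 : ℤ) : ℝ)|) ≤ ∑ i, |(ct i : ℝ)| := by
  refine ⟨fun x hx => ?_, Finset.sum_le_sum fun i _ => ?_⟩
  · -- Zero out the coordinates of `x` where `ct` is negative; this stays in `Kset c`.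
    have hx01 : ∀ i, 0 ≤ x i := fun i => by rcases hx.1 i with h | h <;> simp [h]
    have hy : (fun i => if ct i < 0 then 0 else x i) ∈ Kset c := by
      refine ⟨fun i => ?_, le_trans (Finset.sum_le_sum fun i _ => ?_) hx.2⟩
      · dsimp only
        split_ifs
        · exact Or.inl rfl
        · exact hx.1 i
      · refine mul_le_mul_of_nonneg_left ?_ (by exact_mod_cast hc i)
        dsimp only
        split_ifs
        · exact hx01 i
        · exact le_rfl
    calc ∑ i, ((max (ct i) 0 : ℤ) : ℝ) * x i
        = ∑ i, (ct i : ℝ) * (if ct i < 0 then 0 else x i) := by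
          refine Finset.sum_congr rfl fun i _ => ?_
          split_ifs with h
          · simp [max_eq_right h.le]
          · rw [max_eq_left (not_lt.mp h)]
      _ ≤ ∑ i, (ct i : ℝ) * xstar n ε i := hcrit _ hy
      _ ≤ ∑ i, ((max (ct i) 0 : ℤ) : ℝ) * xstar n ε i := by
          refine Finset.sum_le_sum fun i _ => mul_le_mul_of_nonneg_right ?_ ?_
          · exact_mod_cast le_max_left (ct i) 0
          · unfold xstar
            linarith
  · have h : |max (ct i) 0| ≤ |ct i| := by
      rw [abs_of_nonneg (le_max_right _ _)]
      exact max_le (le_abs_self _) (abs_nonneg _)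
    exact_mod_cast h
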